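/- Let n ≥ 1, ν > 0, D_X ≥ 0, and let f : ℝ^n → ℝ be M-Lipschitz with an L-Lipschitz gradient. Let f_ν(x) = E[f(x + ν u)] be the Gaussian smoothing of f, where u is a standard Gaussian random vector with law N(0, I_n). Then for every x ∈ ℝ^n, ‖ ∇f_ν(x) ‖ ≤ (ν/2) L (n+3)^{3/2} + L D_X + M. -/

import Mathlib

open MeasureTheory ProbabilityTheory Real Finset
open scoped RealInnerProductSpace

noncomputable section

/-- `u` is a standard Gaussian random vector with law `N(0, I_n)` on `ℝⁿ`. -/
def IsStdGaussian {Ω : Type*} [MeasurableSpace Ω] (P : Measure Ω) {n : ℕ}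
    (u : Ω → EuclideanSpace ℝ (Fin n)) : Prop :=
  Measure.map (fun ω => (fun i => u ω i)) P = Measure.pi fun _ : Fin n => gaussianReal 0 1

/-- The gradient of a Lipschitz function is bounded by its Lipschitz constant. -/
theorem norm_gradient_le_of_lipschitzWith {E : Type*} [NormedAddCommGroup E]
    [InnerProductSpace ℝ E] [CompleteSpace E] {g : E → ℝ} {C : NNReal}
    (hg : LipschitzWith C g) (x : E) : ‖gradient g x‖ ≤ C := by
  rw [gradient, LinearIsometryEquiv.norm_map]
  exact norm_fderiv_le_of_lipschitz ℝ hg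

/-- Averaging a Lipschitz function over random translations preserves its Lipschitz constant. -/
theorem LipschitzWith.integral_comp_add {E Ω : Type*} [NormedAddCommGroup E]
    [MeasurableSpace E] [BorelSpace E] [MeasurableSpace Ω] {P : Measure Ω}
    [IsProbabilityMeasure P] {f : E → ℝ} {C : NNReal} (hf : LipschitzWith C f)
    {v : Ω → E} (hv : ∀ x, Measurable fun ω => x + v ω) :
    LipschitzWith C fun x => ∫ ω, f (x + v ω) ∂P := by
  refine LipschitzWith.of_dist_le_mul fun x y => ?_
  have hb : ∀ ω, ‖f (x + v ω) - f (y + v ω)‖ ≤ C * dist x y := fun ω => by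
    simpa [Real.dist_eq] using hf.dist_le_mul (x + v ω) (y + v ω)
  have hm : ∀ z, Measurable fun ω => f (z + v ω) := fun z =>
    hf.continuous.measurable.comp (hv z)
  have hd : Integrable (fun ω => f (x + v ω) - f (y + v ω)) P :=
    .of_bound ((hm x).sub (hm y)).aestronglyMeasurable _ (.of_forall hb)
  by_cases hy : Integrable (fun ω => f (y + v ω)) P
  · have hx : Integrable (fun ω => f (x + v ω)) P := by
      simpa [Pi.add_def] using hd.add hy
    rw [dist_eq_norm, ← integral_sub hx hy]
    simpa using norm_integral_le_of_norm_le_const (μ := P) (.of_forall hb)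
  · have hx : ¬ Integrable (fun ω => f (x + v ω)) P := fun hx => hy (by
      simpa [Pi.sub_def] using hx.sub hd)
    rw [integral_undef hx, integral_undef hy, dist_self]
    positivity

/-- if `f` is `M`-Lipschitz with an `L`-Lipschitz gradient, then the
gradient of its Gaussian smoothing satisfies
`‖∇f_ν(x)‖ ≤ (ν/2) L (n+3)^{3/2} + L D_X + M`. -/
theorem statement3
    {n : ℕ} (hn : 1 ≤ n)
    {Ω : Type*} [MeasurableSpace Ω] (P : Measure Ω) [IsProbabilityMeasure P]
    (ν D_X M L : ℝ) (hν : 0 < ν) (hD : 0 ≤ D_X)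
    (u : Ω → EuclideanSpace ℝ (Fin n))
    (hu : IsStdGaussian P u) (humeas : Measurable u)
    (f : EuclideanSpace ℝ (Fin n) → ℝ)
    (hlip : ∀ x y, |f x - f y| ≤ M * ‖x - y‖)
    (hgradlip : ∀ x y, ‖gradient f x - gradient f y‖ ≤ L * ‖x - y‖)
    (fν : EuclideanSpace ℝ (Fin n) → ℝ)
    (hfν : ∀ x, fν x = ∫ ω, f (x + ν • u ω) ∂P) :
    ∀ x, ‖gradient fν x‖ ≤ ν / 2 * L * ((n : ℝ) + 3) ^ ((3 : ℝ) / 2) + L * D_X + M := by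
  intro x
  have : Nonempty (Fin n) := ⟨⟨0, hn⟩⟩
  obtain ⟨e, he⟩ := exists_ne (0 : EuclideanSpace ℝ (Fin n))
  have he' : 0 < ‖e‖ := norm_pos_iff.2 he
  have hM : 0 ≤ M := by
    have h := (abs_nonneg _).trans (hlip e 0)
    rw [sub_zero] at h
    exact nonneg_of_mul_nonneg_left h he'
  have hL : 0 ≤ L := by
    have h := (norm_nonneg _).trans (hgradlip e 0)
    rw [sub_zero] at h
    exact nonneg_of_mul_nonneg_left h he'
  have hf : LipschitzWith ⟨M, hM⟩ f := LipschitzWith.of_dist_le_mul fun a b => by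
    rw [Real.dist_eq, dist_eq_norm]
    exact hlip a b
  have hfν' : LipschitzWith ⟨M, hM⟩ fν := by
    rw [funext hfν]
    exact hf.integral_comp_add fun z => measurable_const.add (humeas.const_smul ν)
  have hgrad : ‖gradient fν x‖ ≤ M := norm_gradient_le_of_lipschitzWith hfν' x
  have : 0 ≤ ν / 2 * L * ((n : ℝ) + 3) ^ ((3 : ℝ) / 2) := by positivity
  have : 0 ≤ L * D_X := by positivity
  linarith
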